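/- Let ν > 0 and define G(t,x) = (1/|x|) ∫₀^{|x|} e^{−ρ²/(4νt)}/√t dρ for t > 0 and x ∈ ℝ³ \ {0}. Then there exists a constant C > 0, depending only on ν, such that for all i, j ∈ {1,2,3}, all t > 0 and all x ≠ 0, |∂²G/∂xᵢ∂xⱼ(t,x)| ≤ C / (|x|² + νt)^{3/2}. In particular every entry of the Oseen tensor T satisfies |T_{ij}(t,x)| ≤ C' / (|x|² + νt)^{3/2} for some constant C' depending only on ν. -/

import Mathlib

open MeasureTheory

/-- The Oseen potential function `G(t,x) = (1/|x|) ∫₀^{|x|} e^{−ρ²/(4νt)}/√t dρ`. -/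
noncomputable def oseenG (ν : ℝ) (t : ℝ) (x : EuclideanSpace ℝ (Fin 3)) : ℝ :=
  (1 / ‖x‖) * ∫ ρ in (0:ℝ)..‖x‖, Real.exp (-ρ ^ 2 / (4 * ν * t)) / Real.sqrt t

/-- The second partial derivative `∂²G/∂xᵢ∂xⱼ(t,x)` of the Oseen potential. -/
noncomputable def oseenD2G (ν t : ℝ) (x : EuclideanSpace ℝ (Fin 3)) (i j : Fin 3) : ℝ :=
  fderiv ℝ (fun y => fderiv ℝ (oseenG ν t) y (EuclideanSpace.single j 1)) x
    (EuclideanSpace.single i 1)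

/-- The entries of the Oseen tensor: `T_{ii} = −∂²G/∂x_j² − ∂²G/∂x_k²` for the two
other indices `j, k`, and `T_{ij} = ∂²G/∂xᵢ∂xⱼ` for `i ≠ j`. -/
noncomputable def oseenT (ν t : ℝ) (x : EuclideanSpace ℝ (Fin 3)) (i j : Fin 3) : ℝ :=
  if i = j then -∑ k ∈ Finset.univ.erase i, oseenD2G ν t x k k
  else oseenD2G ν t x i j

/-- The incomplete Gaussian integral `∫₀^r e^{−aρ²} dρ`. -/
noncomputable def gaussPrimitive (a r : ℝ) : ℝ := ∫ ρ in (0:ℝ)..r, Real.exp (-a * ρ ^ 2)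

theorem hasDerivAt_gaussPrimitive (a r : ℝ) :
    HasDerivAt (gaussPrimitive a) (Real.exp (-a * r ^ 2)) r := by
  have hc : Continuous fun ρ : ℝ => Real.exp (-a * ρ ^ 2) := by fun_prop
  exact intervalIntegral.integral_hasDerivAt_right (hc.intervalIntegrable _ _)
    (hc.stronglyMeasurableAtFilter _ _) hc.continuousAt

theorem gaussPrimitive_le {a r : ℝ} (ha : 0 < a) (hr : 0 ≤ r) :
    gaussPrimitive a r ≤ 1 / Real.sqrt a := by
  have h1 : gaussPrimitive a r ≤ ∫ ρ in Set.Ioi (0:ℝ), Real.exp (-a * ρ ^ 2) := by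
    rw [gaussPrimitive, intervalIntegral.integral_of_le hr]
    exact setIntegral_mono_set (integrable_exp_neg_mul_sq ha).integrableOn
      (Filter.Eventually.of_forall fun _ => (Real.exp_pos _).le)
      Set.Ioc_subset_Ioi_self.eventuallyLE
  rw [integral_gaussian_Ioi, Real.sqrt_div Real.pi_pos.le] at h1
  have h2 : Real.sqrt Real.pi ≤ 2 := by
    rw [Real.sqrt_le_left (by norm_num)]
    linarith [Real.pi_le_four]
  have hs : 0 < Real.sqrt a := Real.sqrt_pos.2 ha
  refine h1.trans ?_
  rw [div_div, div_le_div_iff₀ (by positivity) hs]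
  nlinarith

theorem gaussPrimitive_sub_eq (a r : ℝ) :
    gaussPrimitive a r - r * Real.exp (-a * r ^ 2) =
      ∫ ρ in (0:ℝ)..r, (Real.exp (-a * ρ ^ 2) - Real.exp (-a * r ^ 2)) := by
  have hc : Continuous fun ρ : ℝ => Real.exp (-a * ρ ^ 2) := by fun_prop
  rw [intervalIntegral.integral_sub (hc.intervalIntegrable _ _) (by simp)]
  simp [gaussPrimitive]

theorem gaussPrimitive_sub_nonneg {a r : ℝ} (ha : 0 < a) (hr : 0 ≤ r) :
    0 ≤ gaussPrimitive a r - r * Real.exp (-a * r ^ 2) := by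
  rw [gaussPrimitive_sub_eq]
  refine intervalIntegral.integral_nonneg hr fun ρ hρ => sub_nonneg.2 (Real.exp_le_exp.2 ?_)
  have : ρ ^ 2 ≤ r ^ 2 := pow_le_pow_left₀ hρ.1 hρ.2 2
  nlinarith

theorem gaussPrimitive_sub_le {a r : ℝ} (ha : 0 < a) (hr : 0 ≤ r) :
    gaussPrimitive a r - r * Real.exp (-a * r ^ 2) ≤ a * r ^ 3 := by
  rw [gaussPrimitive_sub_eq]
  have hc : Continuous fun ρ : ℝ => Real.exp (-a * ρ ^ 2) - Real.exp (-a * r ^ 2) := by fun_prop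
  calc _ ≤ ∫ _ρ in (0:ℝ)..r, a * r ^ 2 := by
        refine intervalIntegral.integral_mono_on hr (hc.intervalIntegrable _ _) (by simp)
          fun ρ _ => ?_
        have h1 : Real.exp (-a * ρ ^ 2) ≤ 1 := Real.exp_le_one_iff.2 (by nlinarith [sq_nonneg ρ])
        linarith [Real.add_one_le_exp (-a * r ^ 2)]
    _ = a * r ^ 3 := by
        rw [intervalIntegral.integral_const, smul_eq_mul]
        ring

/-- The radial factor `h'(r)/r` of the gradient of `h(|x|)`, where
`h(r) = (1/r) ∫₀^r e^{−aρ²} dρ`. -/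
noncomputable def gaussRadial (a r : ℝ) : ℝ :=
  -(gaussPrimitive a r - r * Real.exp (-a * r ^ 2)) / r ^ 3

theorem hasDerivAt_exp_neg_mul_sq (a r : ℝ) :
    HasDerivAt (fun r : ℝ => Real.exp (-a * r ^ 2))
      (Real.exp (-a * r ^ 2) * (-a * (2 * r))) r := by
  simpa using ((hasDerivAt_pow 2 r).const_mul (-a)).exp

theorem hasDerivAt_gaussPrimitive_div (a : ℝ) {r : ℝ} (hr : r ≠ 0) :
    HasDerivAt (fun r => gaussPrimitive a r / r) (r * gaussRadial a r) r := by
  refine ((hasDerivAt_gaussPrimitive a r).div (hasDerivAt_id r) hr).congr_deriv ?_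
  simp only [gaussRadial, id]
  field_simp
  ring

theorem hasDerivAt_gaussRadial (a : ℝ) {r : ℝ} (hr : r ≠ 0) :
    HasDerivAt (gaussRadial a)
      ((3 * ((gaussPrimitive a r - r * Real.exp (-a * r ^ 2)) / r ^ 3)
        - 2 * a * Real.exp (-a * r ^ 2)) / r) r := by
  refine ((((hasDerivAt_gaussPrimitive a r).sub
    ((hasDerivAt_id r).mul (hasDerivAt_exp_neg_mul_sq a r))).neg).div
      (hasDerivAt_pow 3 r) (pow_ne_zero 3 hr)).congr_deriv ?_
  simp
  field_simp
  ring

theorem hasFDerivAt_norm_of_ne_zero {E : Type*} [NormedAddCommGroup E] [InnerProductSpace ℝ E]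
    {x : E} (hx : x ≠ 0) :
    HasFDerivAt (fun y : E => ‖y‖) ((1 / ‖x‖) • innerSL ℝ x) x := by
  have hn : ‖x‖ ≠ 0 := norm_ne_zero_iff.2 hx
  have h := (hasStrictFDerivAt_norm_sq x).hasFDerivAt.sqrt (pow_ne_zero 2 hn)
  simp only [Real.sqrt_sq (norm_nonneg _)] at h
  refine h.congr_fderiv ?_
  ext v
  simp
  field_simp

theorem oseenG_eq (ν t : ℝ) (x : EuclideanSpace ℝ (Fin 3)) :
    oseenG ν t x = 1 / Real.sqrt t * (gaussPrimitive (1 / (4 * ν * t)) ‖x‖ / ‖x‖) := by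
  have h : ∀ ρ : ℝ, -ρ ^ 2 / (4 * ν * t) = -(1 / (4 * ν * t)) * ρ ^ 2 := fun ρ => by ring
  simp only [oseenG, gaussPrimitive, h, intervalIntegral.integral_div]
  ring

theorem fderiv_oseenG_single (ν t : ℝ) {x : EuclideanSpace ℝ (Fin 3)} (hx : x ≠ 0) (j : Fin 3) :
    fderiv ℝ (oseenG ν t) x (EuclideanSpace.single j 1) =
      1 / Real.sqrt t * (gaussRadial (1 / (4 * ν * t)) ‖x‖ * x j) := by
  have hn : ‖x‖ ≠ 0 := norm_ne_zero_iff.2 hx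
  have h := ((hasDerivAt_gaussPrimitive_div (1 / (4 * ν * t)) hn).comp_hasFDerivAt x
    (hasFDerivAt_norm_of_ne_zero hx)).const_mul (1 / Real.sqrt t)
  have h' := h.congr_of_eventuallyEq (f₁ := oseenG ν t) (.of_forall (oseenG_eq ν t))
  rw [h'.fderiv]
  simp only [smul_apply, innerSL_apply_apply, EuclideanSpace.inner_single_right, smul_eq_mul,
    conj_trivial]
  field_simp

theorem oseenD2G_eq (ν t : ℝ) {x : EuclideanSpace ℝ (Fin 3)} (hx : x ≠ 0) (i j : Fin 3) :
    oseenD2G ν t x i j = 1 / Real.sqrt t *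
      (gaussRadial (1 / (4 * ν * t)) ‖x‖ *
          (EuclideanSpace.single i (1:ℝ) : EuclideanSpace ℝ (Fin 3)) j +
        deriv (gaussRadial (1 / (4 * ν * t))) ‖x‖ / ‖x‖ * x i * x j) := by
  have hn : ‖x‖ ≠ 0 := norm_ne_zero_iff.2 hx
  have hev : (fun y => fderiv ℝ (oseenG ν t) y (EuclideanSpace.single j 1)) =ᶠ[nhds x]
      fun y => 1 / Real.sqrt t * (gaussRadial (1 / (4 * ν * t)) ‖y‖ * y j) := by
    filter_upwards [isOpen_ne.mem_nhds hx] with y hy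
    exact fderiv_oseenG_single ν t hy j
  have h := (((hasDerivAt_gaussRadial (1 / (4 * ν * t)) hn).differentiableAt.hasDerivAt
    |>.comp_hasFDerivAt x (hasFDerivAt_norm_of_ne_zero hx)).mul
      (EuclideanSpace.proj (𝕜 := ℝ) j).hasFDerivAt).const_mul (1 / Real.sqrt t)
  have h' : HasFDerivAt
      (fun y => 1 / Real.sqrt t * (gaussRadial (1 / (4 * ν * t)) ‖y‖ * y j)) _ x := h
  rw [oseenD2G, hev.fderiv_eq, h'.fderiv]
  simp only [smul_apply, add_apply, innerSL_apply_apply, EuclideanSpace.inner_single_right,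
    PiLp.proj_apply, Function.comp_apply, smul_eq_mul, conj_trivial]
  ring

theorem abs_oseenD2G_le {ν t : ℝ} (hν : 0 < ν) (ht : 0 < t) {x : EuclideanSpace ℝ (Fin 3)}
    (hx : x ≠ 0) (i j : Fin 3) :
    |oseenD2G ν t x i j| ≤ 1 / Real.sqrt t *
      (4 * ((gaussPrimitive (1 / (4 * ν * t)) ‖x‖
          - ‖x‖ * Real.exp (-(1 / (4 * ν * t)) * ‖x‖ ^ 2)) / ‖x‖ ^ 3)
        + 2 * (1 / (4 * ν * t)) * Real.exp (-(1 / (4 * ν * t)) * ‖x‖ ^ 2)) := by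
  have hn : 0 < ‖x‖ := norm_pos_iff.2 hx
  rw [oseenD2G_eq ν t hx, (hasDerivAt_gaussRadial _ hn.ne').deriv, gaussRadial, abs_mul,
    abs_of_nonneg (by positivity : 0 ≤ 1 / Real.sqrt t)]
  refine mul_le_mul_of_nonneg_left ?_ (by positivity)
  have ha : 0 < 1 / (4 * ν * t) := by positivity
  generalize 1 / (4 * ν * t) = a at ha ⊢
  have hp : 0 ≤ (gaussPrimitive a ‖x‖ - ‖x‖ * Real.exp (-a * ‖x‖ ^ 2)) / ‖x‖ ^ 3 :=
    div_nonneg (gaussPrimitive_sub_nonneg ha hn.le) (by positivity)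
  rw [neg_div]
  generalize (gaussPrimitive a ‖x‖ - ‖x‖ * Real.exp (-a * ‖x‖ ^ 2)) / ‖x‖ ^ 3 = p at hp ⊢
  have he : 0 < 2 * a * Real.exp (-a * ‖x‖ ^ 2) := by positivity
  generalize 2 * a * Real.exp (-a * ‖x‖ ^ 2) = e at he ⊢
  have hδ : |(EuclideanSpace.single i (1:ℝ) : EuclideanSpace ℝ (Fin 3)) j| ≤ 1 := by
    simpa using PiLp.norm_apply_le (EuclideanSpace.single i (1:ℝ)) j
  have hi : |x i| ≤ ‖x‖ := PiLp.norm_apply_le x i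
  have hj : |x j| ≤ ‖x‖ := PiLp.norm_apply_le x j
  have h1 : |-p * (EuclideanSpace.single i (1:ℝ) : EuclideanSpace ℝ (Fin 3)) j| ≤ p := by
    rw [abs_mul, abs_neg, abs_of_nonneg hp]
    exact mul_le_of_le_one_right hp hδ
  have h2 : |(3 * p - e) / ‖x‖ / ‖x‖ * x i * x j| ≤ 3 * p + e := by
    have h3 : |3 * p - e| ≤ 3 * p + e := by
      rw [abs_le]; constructor <;> linarith
    calc |(3 * p - e) / ‖x‖ / ‖x‖ * x i * x j|
        = |3 * p - e| / ‖x‖ / ‖x‖ * |x i| * |x j| := by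
          simp only [abs_mul, abs_div, abs_norm]
      _ ≤ (3 * p + e) / ‖x‖ / ‖x‖ * ‖x‖ * ‖x‖ := by gcongr
      _ = 3 * p + e := by field_simp
  linarith [abs_add_le (-p * (EuclideanSpace.single i (1:ℝ) : EuclideanSpace ℝ (Fin 3)) j)
    ((3 * p - e) / ‖x‖ / ‖x‖ * x i * x j)]

theorem cube_mul_exp_neg_sq_le_one (u : ℝ) : u ^ 3 * Real.exp (-u ^ 2) ≤ 1 := by
  rw [Real.exp_neg, ← div_eq_mul_inv, div_le_one (Real.exp_pos _)]
  have h := Real.quadratic_le_exp_of_nonneg (sq_nonneg u)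
  nlinarith [sq_nonneg (u ^ 2 - u)]

/-- A quantity bounded both by `6s²` and by `6/(s r³)` decays like `(r² + 1/(4s²))^{-3/2}`. -/
theorem mul_sqrt_cube_le {q r s : ℝ} (hq : 0 ≤ q) (hr : 0 ≤ r) (hs : 0 < s)
    (h1 : q ≤ 6 * s ^ 2) (h2 : q * r ^ 3 ≤ 6 / s) :
    q * Real.sqrt (r ^ 2 + 1 / (4 * s ^ 2)) ^ 3 ≤ 27 / s := by
  have hd : 0 < 1 / (2 * s) := by positivity
  have hw : Real.sqrt (r ^ 2 + 1 / (4 * s ^ 2)) ≤ r + 1 / (2 * s) := by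
    rw [Real.sqrt_le_left (by positivity)]
    have : 1 / (4 * s ^ 2) = (1 / (2 * s)) ^ 2 := by field_simp; norm_num
    rw [this]
    nlinarith
  have hcube : (r + 1 / (2 * s)) ^ 3 ≤ 4 * (r ^ 3 + (1 / (2 * s)) ^ 3) := by
    generalize 1 / (2 * s) = d at hd
    nlinarith [mul_nonneg (add_nonneg hr hd.le) (sq_nonneg (r - d))]
  calc q * Real.sqrt (r ^ 2 + 1 / (4 * s ^ 2)) ^ 3
      ≤ q * (4 * (r ^ 3 + (1 / (2 * s)) ^ 3)) := by
        refine mul_le_mul_of_nonneg_left (le_trans ?_ hcube) hq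
        gcongr
    _ = 4 * (q * r ^ 3) + 4 * (q * (1 / (2 * s)) ^ 3) := by ring
    _ ≤ 4 * (6 / s) + 4 * (6 * s ^ 2 * (1 / (2 * s)) ^ 3) := by gcongr
    _ = 27 / s := by field_simp; norm_num

theorem abs_oseenD2G_le_div {ν t : ℝ} (hν : 0 < ν) (ht : 0 < t) {x : EuclideanSpace ℝ (Fin 3)}
    (hx : x ≠ 0) (i j : Fin 3) :
    |oseenD2G ν t x i j| ≤ 54 * Real.sqrt ν / (‖x‖ ^ 2 + ν * t) ^ ((3:ℝ)/2) := by
  have hn : 0 < ‖x‖ := norm_pos_iff.2 hx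
  have hw : 0 < ‖x‖ ^ 2 + ν * t := by positivity
  have hpow : (‖x‖ ^ 2 + ν * t) ^ ((3:ℝ)/2) = Real.sqrt (‖x‖ ^ 2 + ν * t) ^ 3 := by
    rw [Real.sqrt_eq_rpow, ← Real.rpow_natCast (_ ^ (1 / 2 : ℝ)) 3, ← Real.rpow_mul hw.le]
    norm_num
  rw [hpow, le_div_iff₀ (by positivity)]
  have ha : 0 < 1 / (4 * ν * t) := by positivity
  have hM := abs_oseenD2G_le hν ht hx i j
  have hνt : ν * t = 1 / (4 * (1 / (4 * ν * t))) := by field_simp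
  have hsa : Real.sqrt (1 / (4 * ν * t)) = 1 / (2 * Real.sqrt ν * Real.sqrt t) := by
    rw [Real.sqrt_div zero_le_one, Real.sqrt_one, Real.sqrt_mul (by positivity),
      Real.sqrt_mul (by positivity), show (4:ℝ) = 2 ^ 2 by norm_num,
      Real.sqrt_sq (by norm_num)]
  rw [hνt]
  generalize 1 / (4 * ν * t) = a at ha hM hsa ⊢
  have hs : 0 < Real.sqrt a := Real.sqrt_pos.2 ha
  have hss : Real.sqrt a ^ 2 = a := Real.sq_sqrt ha.le
  have hp0 := gaussPrimitive_sub_nonneg ha hn.le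
  have hp1 := gaussPrimitive_sub_le ha hn.le
  have he0 : 0 < Real.exp (-a * ‖x‖ ^ 2) := Real.exp_pos _
  have he1 : Real.exp (-a * ‖x‖ ^ 2) ≤ 1 := Real.exp_le_one_iff.2 (by nlinarith [sq_nonneg ‖x‖])
  have hp2 : gaussPrimitive a ‖x‖ - ‖x‖ * Real.exp (-a * ‖x‖ ^ 2) ≤ 1 / Real.sqrt a := by
    linarith [gaussPrimitive_le ha hn.le, mul_pos hn he0]
  have he2 : a * ‖x‖ ^ 3 * Real.exp (-a * ‖x‖ ^ 2) ≤ 1 / Real.sqrt a := by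
    rw [le_div_iff₀ hs]
    have h := cube_mul_exp_neg_sq_le_one (Real.sqrt a * ‖x‖)
    rw [mul_pow _ _ 2, hss, ← neg_mul] at h
    calc _ = (Real.sqrt a ^ 2 * Real.sqrt a) * ‖x‖ ^ 3 * Real.exp (-a * ‖x‖ ^ 2) := by
          rw [hss]; ring
      _ = (Real.sqrt a * ‖x‖) ^ 3 * Real.exp (-a * ‖x‖ ^ 2) := by ring
      _ ≤ 1 := h
  generalize gaussPrimitive a ‖x‖ - ‖x‖ * Real.exp (-a * ‖x‖ ^ 2) = p at *
  generalize Real.exp (-a * ‖x‖ ^ 2) = e at *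
  have hq1 : 4 * (p / ‖x‖ ^ 3) + 2 * a * e ≤ 6 * Real.sqrt a ^ 2 := by
    have : p / ‖x‖ ^ 3 ≤ a := (div_le_iff₀ (by positivity)).2 hp1
    rw [hss]
    nlinarith
  have hq2 : (4 * (p / ‖x‖ ^ 3) + 2 * a * e) * ‖x‖ ^ 3 ≤ 6 / Real.sqrt a := by
    calc _ = 4 * p + 2 * (a * ‖x‖ ^ 3 * e) := by field_simp
      _ ≤ 4 * (1 / Real.sqrt a) + 2 * (1 / Real.sqrt a) := by gcongr
      _ = 6 / Real.sqrt a := by ring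
  have hmain := mul_sqrt_cube_le (by positivity) hn.le hs hq1 hq2
  rw [hss] at hmain
  calc _ ≤ 1 / Real.sqrt t * (4 * (p / ‖x‖ ^ 3) + 2 * a * e)
        * Real.sqrt (‖x‖ ^ 2 + 1 / (4 * a)) ^ 3 := by gcongr
    _ = 1 / Real.sqrt t * ((4 * (p / ‖x‖ ^ 3) + 2 * a * e)
        * Real.sqrt (‖x‖ ^ 2 + 1 / (4 * a)) ^ 3) := by ring
    _ ≤ 1 / Real.sqrt t * (27 / Real.sqrt a) := by gcongr
    _ = 54 * Real.sqrt ν := by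
      have : 0 < Real.sqrt t := Real.sqrt_pos.2 ht
      have : 0 < Real.sqrt ν := Real.sqrt_pos.2 hν
      rw [hsa]
      field_simp
      norm_num

/-- Basic estimate for the Oseen tensor: `|∂²G/∂xᵢ∂xⱼ(t,x)| ≤ C/(|x|²+νt)^{3/2}`
and consequently `|T_{ij}(t,x)| ≤ C′/(|x|²+νt)^{3/2}`, with constants depending
only on `ν`. -/
theorem oseen_tensor_estimate (ν : ℝ) (hν : 0 < ν) :
    (∃ C : ℝ, 0 < C ∧ ∀ i j : Fin 3, ∀ t : ℝ, 0 < t →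
      ∀ x : EuclideanSpace ℝ (Fin 3), x ≠ 0 →
        |oseenD2G ν t x i j| ≤ C / (‖x‖ ^ 2 + ν * t) ^ ((3:ℝ)/2)) ∧
    (∃ C' : ℝ, 0 < C' ∧ ∀ i j : Fin 3, ∀ t : ℝ, 0 < t →
      ∀ x : EuclideanSpace ℝ (Fin 3), x ≠ 0 →
        |oseenT ν t x i j| ≤ C' / (‖x‖ ^ 2 + ν * t) ^ ((3:ℝ)/2)) := by
  have hs : 0 < Real.sqrt ν := Real.sqrt_pos.2 hν
  refine ⟨⟨54 * Real.sqrt ν, by positivity, fun i j t ht x hx =>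
    abs_oseenD2G_le_div hν ht hx i j⟩, 2 * (54 * Real.sqrt ν), by positivity,
    fun i j t ht x hx => ?_⟩
  have hb := fun k l => abs_oseenD2G_le_div hν ht hx k l
  rw [mul_div_assoc, oseenT]
  split_ifs with hij
  · rw [abs_neg]
    calc _ ≤ ∑ k ∈ Finset.univ.erase i, |oseenD2G ν t x k k| := Finset.abs_sum_le_sum_abs _ _
      _ ≤ _ := Finset.sum_le_card_nsmul _ _ _ fun k _ => hb k k
      _ = _ := by simp
  · linarith [hb i j, abs_nonneg (oseenD2G ν t x i j)]
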